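/- Let N ≥ 2, K ≥ 0, and let f : ℝ^N → ℝ be smooth with ∇²f(v,v) ≥ −(N−1)K|v|² for all vectors v. Let D > 0, α ∈ ℝ, let q be a smooth function on an open set U ⊆ ℝ^N × ℝ, and let h be a smooth nonpositive function on U satisfying Δ_f h − ∂ₜh + |∇h|² + q·(D·e^h)^{α−1} = 0 on U. Let β ∈ ℝ satisfy β − h > 0 on U, and set w := |∇h|²/(β−h)². Then at every point of U: Δ_f w − ∂ₜw ≥ (2(h + (1−β))/(β−h))·⟨∇h, ∇w⟩ + 2(β−h)·w² − 2(N−1)K·w − 2·(α + h/(β−h) + (1−β)/(β−h))·(D·e^h)^{α−1}·q·w − (2/(β−h)²)·(D·e^h)^{α−1}·⟨∇h, ∇q⟩. -/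

import Mathlib

open Real Set Metric Filter
open scoped RealInnerProductSpace Topology

noncomputable section

/-- The Hessian of `f : ℝ^N → ℝ` at `x`, evaluated on the pair of vectors `(v, w)`. -/
def hess {N : ℕ} (f : EuclideanSpace ℝ (Fin N) → ℝ) (x v w : EuclideanSpace ℝ (Fin N)) : ℝ :=
  ⟪fderiv ℝ (gradient f) x v, w⟫

/-- The Laplacian of `f : ℝ^N → ℝ` at `x` (trace of the Hessian). -/
def lap {N : ℕ} (f : EuclideanSpace ℝ (Fin N) → ℝ) (x : EuclideanSpace ℝ (Fin N)) : ℝ :=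
  ∑ i, hess f x (EuclideanSpace.single i 1) (EuclideanSpace.single i 1)

/-- The weighted (drift) Laplacian `Δ_f u = Δ u − ⟨∇f, ∇u⟩`. -/
def wlap {N : ℕ} (f u : EuclideanSpace ℝ (Fin N) → ℝ) (x : EuclideanSpace ℝ (Fin N)) : ℝ :=
  lap u x - ⟪gradient f x, gradient u x⟫

/-- Spatial gradient of a space-time function. -/
def sgrad {N : ℕ} (u : EuclideanSpace ℝ (Fin N) × ℝ → ℝ) (p : EuclideanSpace ℝ (Fin N) × ℝ) :
    EuclideanSpace ℝ (Fin N) :=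
  gradient (fun y => u (y, p.2)) p.1

/-- Spatial weighted Laplacian `Δ_f u(·,t)` of a space-time function. -/
def swlap {N : ℕ} (f : EuclideanSpace ℝ (Fin N) → ℝ) (u : EuclideanSpace ℝ (Fin N) × ℝ → ℝ)
    (p : EuclideanSpace ℝ (Fin N) × ℝ) : ℝ :=
  wlap f (fun y => u (y, p.2)) p.1

/-- Time derivative `∂ₜ u` of a space-time function. -/
def tderiv {N : ℕ} (u : EuclideanSpace ℝ (Fin N) × ℝ → ℝ) (p : EuclideanSpace ℝ (Fin N) × ℝ) : ℝ :=
  deriv (fun s => u (p.1, s)) p.2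

/-- The parabolic cylinder `Q_{R,T} = B̄(x₀,R) × [t₀ − T, t₀]`. -/
def cyl {N : ℕ} (x₀ : EuclideanSpace ℝ (Fin N)) (R t₀ T : ℝ) :
    Set (EuclideanSpace ℝ (Fin N) × ℝ) :=
  (closedBall x₀ R) ×ˢ (Icc (t₀ - T) t₀)

/-- `μ := max_{|x−x₀|=1} ((N−1) − ⟨∇f(x), x−x₀⟩)`. -/
def muConst {N : ℕ} (f : EuclideanSpace ℝ (Fin N) → ℝ) (x₀ : EuclideanSpace ℝ (Fin N)) : ℝ :=
  sSup ((fun x => ((N : ℝ) - 1) - ⟪gradient f x, x - x₀⟫) '' sphere x₀ 1)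

/-- Directional derivative of a space-time function. -/
def dd {V : Type*} [NormedAddCommGroup V] [NormedSpace ℝ V] (a : V) (u : V → ℝ) (p : V) : ℝ :=
  fderiv ℝ u p a

section rules
variable {V : Type*} [NormedAddCommGroup V] [NormedSpace ℝ V]

theorem dd_congr {U : Set V} (hU : IsOpen U) {u v : V → ℝ} (h : ∀ p ∈ U, u p = v p) (a : V) :
    ∀ p ∈ U, dd a u p = dd a v p := by
  intro p hp
  have : u =ᶠ[𝓝 p] v := by
    filter_upwards [hU.mem_nhds hp] with x hx using h x hx
  unfold dd
  rw [this.fderiv_eq]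

theorem smooth_dd {U : Set V} (hU : IsOpen U) {u : V → ℝ} (h : ContDiffOn ℝ (⊤ : ℕ∞) u U) (a : V) :
    ContDiffOn ℝ (⊤ : ℕ∞) (dd a u) U := by
  have := h.fderiv_of_isOpen (m := (⊤ : ℕ∞)) hU (by simp)
  exact this.clm_apply contDiffOn_const

theorem smooth_diff {U : Set V} (hU : IsOpen U) {u : V → ℝ} (h : ContDiffOn ℝ (⊤ : ℕ∞) u U) :
    ∀ p ∈ U, DifferentiableAt ℝ u p := by
  intro p hp
  exact (h.contDiffAt (hU.mem_nhds hp)).differentiableAt (by simp)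

theorem dd_comm {U : Set V} (hU : IsOpen U) {u : V → ℝ} (h : ContDiffOn ℝ (⊤ : ℕ∞) u U) (a b : V) :
    ∀ p ∈ U, dd a (dd b u) p = dd b (dd a u) p := by
  intro p hp
  have h2 : DifferentiableAt ℝ (fderiv ℝ u) p :=
    ((h.fderiv_of_isOpen (m := (⊤ : ℕ∞)) hU (by simp)).contDiffAt (hU.mem_nhds hp)).differentiableAt
      (by simp)
  have key : ∀ c d : V, dd c (dd d u) p = fderiv ℝ (fderiv ℝ u) p c d := by
    intro c d
    have := fderiv_clm_apply h2 (differentiableAt_const d)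
    unfold dd
    rw [this]
    simp
  rw [key, key]
  have hs : IsSymmSndFDerivAt ℝ u p :=
    (h.contDiffAt (hU.mem_nhds hp)).isSymmSndFDerivAt (by
      simp only [minSmoothness_of_isRCLikeNormedField]
      exact WithTop.coe_le_coe.2 (le_top : (2 : ℕ∞) ≤ ⊤))
  exact hs a b

theorem dd_mul {u v : V → ℝ} {p : V} (hu : DifferentiableAt ℝ u p) (hv : DifferentiableAt ℝ v p)
    (a : V) : dd a (fun x => u x * v x) p = dd a u p * v p + u p * dd a v p := by
  unfold dd
  rw [fderiv_fun_mul hu hv]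
  simp
  ring

theorem dd_add {u v : V → ℝ} {p : V} (hu : DifferentiableAt ℝ u p) (hv : DifferentiableAt ℝ v p)
    (a : V) : dd a (fun x => u x + v x) p = dd a u p + dd a v p := by
  unfold dd
  rw [fderiv_fun_add hu hv]
  simp

theorem dd_sub {u v : V → ℝ} {p : V} (hu : DifferentiableAt ℝ u p) (hv : DifferentiableAt ℝ v p)
    (a : V) : dd a (fun x => u x - v x) p = dd a u p - dd a v p := by
  unfold dd
  rw [fderiv_fun_sub hu hv]
  simp

theorem dd_pow {u : V → ℝ} {p : V} (hu : DifferentiableAt ℝ u p) (n : ℕ)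
    (a : V) : dd a (fun x => u x ^ n) p = n * u p ^ (n - 1) * dd a u p := by
  unfold dd
  rw [fderiv_fun_pow n hu]
  simp

theorem dd_const (c : ℝ) (a p : V) : dd a (fun _ => c) p = 0 := by
  unfold dd
  simp

theorem dd_const_mul {u : V → ℝ} {p : V} (hu : DifferentiableAt ℝ u p) (c : ℝ)
    (a : V) : dd a (fun x => c * u x) p = c * dd a u p := by
  rw [dd_mul (differentiableAt_const c) hu, dd_const]
  ring

theorem dd_sum {ι : Type*} [Fintype ι] {u : ι → V → ℝ} {p : V}
    (hu : ∀ i, DifferentiableAt ℝ (u i) p) (a : V) :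
    dd a (fun x => ∑ i, u i x) p = ∑ i, dd a (u i) p := by
  unfold dd
  rw [fderiv_fun_sum (fun i _ => hu i)]
  simp

theorem dd_inv {u : V → ℝ} {p : V} (β : ℝ) (hu : DifferentiableAt ℝ u p) (hne : β - u p ≠ 0) (a : V) :
    dd a (fun x => (β - u x)⁻¹) p = (β - u p)⁻¹ ^ 2 * dd a u p := by
  have h1 : HasFDerivAt (fun x => β - u x) (-fderiv ℝ u p) p := hu.hasFDerivAt.const_sub β
  have h2 := (hasDerivAt_inv hne).comp_hasFDerivAt p h1
  unfold dd
  have h3 : fderiv ℝ (fun x => (β - u x)⁻¹) p = _ := h2.fderiv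
  rw [h3]
  simp

theorem dd_rpow {u : V → ℝ} {p : V} (D α : ℝ) (hD : 0 < D) (hu : DifferentiableAt ℝ u p) (a : V) :
    DifferentiableAt ℝ (fun x => (D * Real.exp (u x)) ^ (α - 1)) p ∧
    dd a (fun x => (D * Real.exp (u x)) ^ (α - 1)) p
      = (α - 1) * (D * Real.exp (u p)) ^ (α - 1) * dd a u p := by
  have e : ∀ x, (D * Real.exp (u x)) ^ (α - 1) = Real.exp ((Real.log D + u x) * (α - 1)) := by
    intro x
    rw [Real.rpow_def_of_pos (by positivity), Real.log_mul hD.ne' (Real.exp_pos _).ne', Real.log_exp]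
  have h1 : HasFDerivAt (fun x => Real.exp ((Real.log D + u x) * (α - 1))) _ p :=
    ((hu.hasFDerivAt.const_add (Real.log D)).mul_const (α - 1)).exp
  simp only [e]
  refine ⟨h1.differentiableAt, ?_⟩
  unfold dd
  rw [h1.fderiv]
  simp
  ring

end rules

section slices
variable {N : ℕ}

/-- The spatial coordinate direction in space-time. -/
def ee (i : Fin N) : EuclideanSpace ℝ (Fin N) × ℝ := (EuclideanSpace.single i 1, 0)

/-- The time direction in space-time. -/
def et : EuclideanSpace ℝ (Fin N) × ℝ := (0, 1)

theorem slice_fderiv {u : EuclideanSpace ℝ (Fin N) × ℝ → ℝ} {x : EuclideanSpace ℝ (Fin N)} {t : ℝ}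
    (hu : DifferentiableAt ℝ u (x, t)) (v : EuclideanSpace ℝ (Fin N)) :
    fderiv ℝ (fun y => u (y, t)) x v = dd (v, 0) u (x, t) := by
  have h1 : HasFDerivAt (fun y : EuclideanSpace ℝ (Fin N) => (y, t)) _ x :=
    hasFDerivAt_prodMk_left (𝕜 := ℝ) x t
  have h2 : HasFDerivAt (fun y => u (y, t)) _ x := HasFDerivAt.comp x hu.hasFDerivAt h1
  rw [h2.fderiv]
  simp [dd]

theorem tderiv_eq {u : EuclideanSpace ℝ (Fin N) × ℝ → ℝ} {p : EuclideanSpace ℝ (Fin N) × ℝ}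
    (hu : DifferentiableAt ℝ u p) : tderiv u p = dd et u p := by
  have h1 : HasFDerivAt (fun s : ℝ => (p.1, s)) _ p.2 :=
    hasFDerivAt_prodMk_right (𝕜 := ℝ) p.1 p.2
  have h2 : HasFDerivAt (fun s => u (p.1, s)) _ p.2 := HasFDerivAt.comp p.2 (g := u) (f := fun s : ℝ => (p.1, s)) hu.hasFDerivAt h1
  unfold tderiv
  rw [← fderiv_apply_one_eq_deriv, h2.fderiv]
  simp [dd, et]

theorem inner_grad (u : EuclideanSpace ℝ (Fin N) → ℝ) (x v : EuclideanSpace ℝ (Fin N)) :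
    ⟪gradient u x, v⟫ = fderiv ℝ u x v := by
  simp [gradient]

theorem inner_sgrad {u : EuclideanSpace ℝ (Fin N) × ℝ → ℝ} {p : EuclideanSpace ℝ (Fin N) × ℝ}
    (hu : DifferentiableAt ℝ u p) (v : EuclideanSpace ℝ (Fin N)) :
    ⟪sgrad u p, v⟫ = dd (v, 0) u p := by
  unfold sgrad
  rw [inner_grad, slice_fderiv hu]

theorem sgrad_apply {u : EuclideanSpace ℝ (Fin N) × ℝ → ℝ} {p : EuclideanSpace ℝ (Fin N) × ℝ}
    (hu : DifferentiableAt ℝ u p) (i : Fin N) : sgrad u p i = dd (ee i) u p := by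
  have := inner_sgrad hu (EuclideanSpace.single i 1)
  rw [EuclideanSpace.inner_single_right] at this
  simpa [ee] using this

theorem hess_slice {U : Set (EuclideanSpace ℝ (Fin N) × ℝ)} (hU : IsOpen U)
    {u : EuclideanSpace ℝ (Fin N) × ℝ → ℝ} (hu : ContDiffOn ℝ (⊤ : ℕ∞) u U)
    {p : EuclideanSpace ℝ (Fin N) × ℝ} (hp : p ∈ U) (v w : EuclideanSpace ℝ (Fin N)) :
    hess (fun y => u (y, p.2)) p.1 v w = dd (v, 0) (dd (w, 0) u) p := by
  have hc : ContDiffAt ℝ (⊤ : ℕ∞) (fun y => u (y, p.2)) p.1 := by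
    have h1 : ContDiffAt ℝ (⊤ : ℕ∞) u (p.1, p.2) := hu.contDiffAt (hU.mem_nhds hp)
    exact h1.comp p.1 (f := fun y : EuclideanSpace ℝ (Fin N) => (y, p.2)) (by fun_prop)
  have hd : DifferentiableAt ℝ (fderiv ℝ (fun y => u (y, p.2))) p.1 :=
    (hc.fderiv_right (m := (⊤ : ℕ∞)) (by simp)).differentiableAt (by simp)
  have hg : DifferentiableAt ℝ (gradient (fun y => u (y, p.2))) p.1 :=
    (InnerProductSpace.toDual ℝ (EuclideanSpace ℝ (Fin N))).symm.toContinuousLinearEquiv.differentiable.differentiableAt.comp p.1 hd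
  unfold hess
  have e1 : fderiv ℝ (fun y => ⟪gradient (fun y => u (y, p.2)) y, w⟫) p.1 v
      = ⟪fderiv ℝ (gradient (fun y => u (y, p.2))) p.1 v, w⟫ := by
    rw [fderiv_inner_apply ℝ hg (differentiableAt_const w)]
    simp
  rw [← e1]
  have e2 : (fun y => ⟪gradient (fun y => u (y, p.2)) y, w⟫) =ᶠ[𝓝 p.1] fun y => dd (w, 0) u (y, p.2) := by
    have hn : ∀ᶠ y in 𝓝 p.1, (y, p.2) ∈ U := by
      have hcont : ContinuousAt (fun y : EuclideanSpace ℝ (Fin N) => (y, p.2)) p.1 := by fun_prop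
      exact hcont.eventually_mem (hU.mem_nhds hp)
    filter_upwards [hn] with y hy
    rw [inner_grad, slice_fderiv (smooth_diff hU hu _ hy)]
  rw [e2.fderiv_eq]
  exact slice_fderiv (smooth_diff hU (smooth_dd hU hu _) p hp) v

theorem inner_coord (x y : EuclideanSpace ℝ (Fin N)) : ⟪x, y⟫ = ∑ i, x i * y i := by
  simp [PiLp.inner_apply, mul_comm]

theorem norm_sgrad {u : EuclideanSpace ℝ (Fin N) × ℝ → ℝ} {p : EuclideanSpace ℝ (Fin N) × ℝ}
    (hu : DifferentiableAt ℝ u p) : ‖sgrad u p‖ ^ 2 = ∑ i, dd (ee i) u p ^ 2 := by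
  rw [EuclideanSpace.norm_sq_eq]
  simp [sgrad_apply hu]

theorem swlap_eq {U : Set (EuclideanSpace ℝ (Fin N) × ℝ)} (hU : IsOpen U)
    {f : EuclideanSpace ℝ (Fin N) → ℝ} (hf : ContDiff ℝ (⊤ : ℕ∞) f)
    {u : EuclideanSpace ℝ (Fin N) × ℝ → ℝ} (hu : ContDiffOn ℝ (⊤ : ℕ∞) u U)
    {p : EuclideanSpace ℝ (Fin N) × ℝ} (hp : p ∈ U) :
    swlap f u p = (∑ i, dd (ee i) (dd (ee i) u) p)
      - ∑ i, dd (ee i) (fun z => f z.1) p * dd (ee i) u p := by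
  have hF : DifferentiableAt ℝ (fun z : EuclideanSpace ℝ (Fin N) × ℝ => f z.1) p :=
    (hf.differentiable (by simp)).differentiableAt.comp p differentiableAt_fst
  have hfg : gradient f p.1 = sgrad (fun z => f z.1) p := rfl
  have hug : gradient (fun y => u (y, p.2)) p.1 = sgrad u p := rfl
  unfold swlap wlap lap
  rw [hfg, hug, inner_coord]
  simp only [hess_slice hU hu hp, sgrad_apply hF, sgrad_apply (smooth_diff hU hu p hp)]
  rfl

theorem hess_f {f : EuclideanSpace ℝ (Fin N) → ℝ} (hf : ContDiff ℝ (⊤ : ℕ∞) f)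
    (p : EuclideanSpace ℝ (Fin N) × ℝ) (v : EuclideanSpace ℝ (Fin N)) :
    hess f p.1 v v = ∑ i, ∑ j, v i * v j * dd (ee i) (dd (ee j) (fun z => f z.1)) p := by
  have hF : ContDiffOn ℝ (⊤ : ℕ∞) (fun z : EuclideanSpace ℝ (Fin N) × ℝ => f z.1) univ :=
    (hf.comp contDiff_fst).contDiffOn
  have h1 := hess_slice isOpen_univ hF (mem_univ p) v v
  have hv : ((v, 0) : EuclideanSpace ℝ (Fin N) × ℝ) = ∑ i, v i • ee i := by
    have : v = ∑ i, v i • EuclideanSpace.single i (1 : ℝ) := by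
      ext j
      simp [Finset.sum_apply, Pi.single_apply]
    ext1
    · rw [Prod.fst_sum]
      simpa [ee] using this
    · simp [Prod.snd_sum, ee]
  have hlin : ∀ (u : EuclideanSpace ℝ (Fin N) × ℝ → ℝ) z, dd (v, 0) u z = ∑ i, v i * dd (ee i) u z := by
    intro u z
    unfold dd
    rw [hv]
    simp
  change hess f p.1 v v = _ at h1
  rw [h1, hlin]
  refine Finset.sum_congr rfl fun i _ => ?_
  have e : dd (v, 0) (fun z : EuclideanSpace ℝ (Fin N) × ℝ => f z.1)
      = fun z => ∑ j, v j * dd (ee j) (fun z => f z.1) z := funext (hlin _)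
  have hd : ∀ j, DifferentiableAt ℝ (dd (ee j) (fun z : EuclideanSpace ℝ (Fin N) × ℝ => f z.1)) p :=
    fun j => smooth_diff isOpen_univ (smooth_dd isOpen_univ hF _) p (mem_univ p)
  rw [e, dd_sum (fun j => (hd j).const_mul _), Finset.mul_sum]
  refine Finset.sum_congr rfl fun j _ => ?_
  rw [dd_const_mul (hd j)]
  ring

end slices

section main
variable {V : Type*} [NormedAddCommGroup V] [NormedSpace ℝ V]

theorem dd_w1 {ι : Type*} [Fintype ι] {U : Set V} (hU : IsOpen U) {h : V → ℝ}
    (hh : ContDiffOn ℝ (⊤ : ℕ∞) h U) (β : ℝ) (hβ : ∀ p ∈ U, 0 < β - h p) (e : ι → V) (a : V) :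
    ∀ p ∈ U, dd a (fun z => (∑ j, dd (e j) h z ^ 2) * (β - h z)⁻¹ ^ 2) p
      = 2 * ((∑ j, dd (e j) h p * dd a (dd (e j) h) p) * (β - h p)⁻¹ ^ 2)
        + 2 * ((∑ j, dd (e j) h p ^ 2) * ((β - h p)⁻¹ ^ 3 * dd a h p)) := by
  intro p hp
  have d0 := smooth_diff hU hh p hp
  have d1 : ∀ j, DifferentiableAt ℝ (dd (e j) h) p := fun j =>
    smooth_diff hU (smooth_dd hU hh _) p hp
  have hne : β - h p ≠ 0 := (hβ p hp).ne'
  have dC : DifferentiableAt ℝ (fun z => (β - h z)⁻¹) p := (d0.const_sub β).inv hne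
  rw [dd_mul (DifferentiableAt.fun_sum fun j _ => (d1 j).fun_pow 2) (dC.fun_pow 2),
    dd_sum (fun j => (d1 j).fun_pow 2), dd_pow dC, dd_inv β d0 hne]
  simp only [dd_pow (d1 _)]
  have : ∑ j, ((2 : ℕ) : ℝ) * dd (e j) h p ^ (2 - 1) * dd a (dd (e j) h) p
      = 2 * ∑ j, dd (e j) h p * dd a (dd (e j) h) p := by
    rw [Finset.mul_sum]
    refine Finset.sum_congr rfl fun j _ => ?_
    norm_num
    ring
  rw [this]
  generalize (β - h p)⁻¹ = C
  norm_num
  ring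

theorem dd_w2 {ι : Type*} [Fintype ι] {U : Set V} (hU : IsOpen U) {h : V → ℝ}
    (hh : ContDiffOn ℝ (⊤ : ℕ∞) h U) (β : ℝ) (hβ : ∀ p ∈ U, 0 < β - h p) (e : ι → V) (a : V) :
    ∀ p ∈ U, dd a (dd a (fun z => (∑ j, dd (e j) h z ^ 2) * (β - h z)⁻¹ ^ 2)) p
      = 2 * (∑ j, dd a (dd (e j) h) p ^ 2) * (β - h p)⁻¹ ^ 2
        + 2 * (∑ j, dd (e j) h p * dd (e j) (dd a (dd a h)) p) * (β - h p)⁻¹ ^ 2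
        + 8 * (∑ j, dd (e j) h p * dd a (dd (e j) h) p) * (β - h p)⁻¹ ^ 3 * dd a h p
        + 6 * (∑ j, dd (e j) h p ^ 2) * (β - h p)⁻¹ ^ 4 * dd a h p ^ 2
        + 2 * (∑ j, dd (e j) h p ^ 2) * (β - h p)⁻¹ ^ 3 * dd a (dd a h) p := by
  intro p hp
  rw [dd_congr hU (dd_w1 hU hh β hβ e a) a p hp]
  have d0 := smooth_diff hU hh p hp
  have da := smooth_diff hU (smooth_dd hU hh a) p hp
  have d1 : ∀ j, DifferentiableAt ℝ (dd (e j) h) p := fun j =>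
    smooth_diff hU (smooth_dd hU hh _) p hp
  have d2 : ∀ j, DifferentiableAt ℝ (dd a (dd (e j) h)) p := fun j =>
    smooth_diff hU (smooth_dd hU (smooth_dd hU hh _) _) p hp
  have hne : β - h p ≠ 0 := (hβ p hp).ne'
  have dC : DifferentiableAt ℝ (fun z => (β - h z)⁻¹) p := (d0.const_sub β).inv hne
  have dS : DifferentiableAt ℝ (fun z => ∑ j, dd (e j) h z * dd a (dd (e j) h) z) p :=
    DifferentiableAt.fun_sum fun j _ => (d1 j).fun_mul (d2 j)
  have dG : DifferentiableAt ℝ (fun z => ∑ j, dd (e j) h z ^ 2) p :=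
    DifferentiableAt.fun_sum fun j _ => (d1 j).fun_pow 2
  rw [dd_add ((dS.fun_mul (dC.fun_pow 2)).const_mul 2) ((dG.fun_mul ((dC.fun_pow 3).fun_mul da)).const_mul 2),
    dd_const_mul (dS.fun_mul (dC.fun_pow 2)), dd_const_mul (dG.fun_mul ((dC.fun_pow 3).fun_mul da)),
    dd_mul dS (dC.fun_pow 2), dd_mul dG ((dC.fun_pow 3).fun_mul da), dd_mul (dC.fun_pow 3) da,
    dd_pow dC, dd_pow dC, dd_inv β d0 hne, dd_sum (fun j => (d1 j).fun_pow 2),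
    dd_sum (fun j => (d1 j).fun_mul (d2 j))]
  simp only [dd_pow (d1 _), dd_mul (d1 _) (d2 _)]
  have e1 : ∑ j, ((2 : ℕ) : ℝ) * dd (e j) h p ^ (2 - 1) * dd a (dd (e j) h) p
      = 2 * ∑ j, dd (e j) h p * dd a (dd (e j) h) p := by
    rw [Finset.mul_sum]
    refine Finset.sum_congr rfl fun j _ => ?_
    norm_num
    ring
  have e2 : ∑ j, (dd a (dd (e j) h) p * dd a (dd (e j) h) p
        + dd (e j) h p * dd a (dd a (dd (e j) h)) p)
      = (∑ j, dd a (dd (e j) h) p ^ 2) + ∑ j, dd (e j) h p * dd (e j) (dd a (dd a h)) p := by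
    rw [← Finset.sum_add_distrib]
    refine Finset.sum_congr rfl fun j _ => ?_
    rw [dd_congr hU (dd_comm hU hh a (e j)) a p hp, dd_comm hU (smooth_dd hU hh a) a (e j) p hp]
    ring
  rw [e1, e2]
  generalize (β - h p)⁻¹ = C
  norm_num
  ring

end main

/-- **Lemma 2.1, Euclidean case.** The key differential inequality satisfied by
`w = |∇h|²/(β−h)²` for a nonpositive solution `h` of
`Δ_f h − ∂ₜ h + |∇h|² + q (D e^h)^{α−1} = 0`. -/
theorem key_lemma_differential_inequality (N : ℕ) (hN : 2 ≤ N) (K : ℝ) (hK : 0 ≤ K)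
    (f : EuclideanSpace ℝ (Fin N) → ℝ) (hf : ContDiff ℝ (⊤ : ℕ∞) f)
    (hRic : ∀ x v, -(((N : ℝ) - 1) * K * ‖v‖ ^ 2) ≤ hess f x v v)
    (D α β : ℝ) (hD : 0 < D)
    (U : Set (EuclideanSpace ℝ (Fin N) × ℝ)) (hU : IsOpen U)
    (q : EuclideanSpace ℝ (Fin N) × ℝ → ℝ) (hq : ContDiffOn ℝ (⊤ : ℕ∞) q U)
    (h : EuclideanSpace ℝ (Fin N) × ℝ → ℝ) (hh : ContDiffOn ℝ (⊤ : ℕ∞) h U)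
    (hhle : ∀ p ∈ U, h p ≤ 0)
    (heq : ∀ p ∈ U,
      swlap f h p - tderiv h p + ‖sgrad h p‖ ^ 2 + q p * (D * Real.exp (h p)) ^ (α - 1) = 0)
    (hβ : ∀ p ∈ U, 0 < β - h p) :
    ∀ p ∈ U,
      swlap f (fun p' => ‖sgrad h p'‖ ^ 2 / (β - h p') ^ 2) p
        - tderiv (fun p' => ‖sgrad h p'‖ ^ 2 / (β - h p') ^ 2) p ≥
      2 * (h p + (1 - β)) / (β - h p) *
          ⟪sgrad h p, sgrad (fun p' => ‖sgrad h p'‖ ^ 2 / (β - h p') ^ 2) p⟫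
        + 2 * (β - h p) * (‖sgrad h p‖ ^ 2 / (β - h p) ^ 2) ^ 2
        - 2 * ((N : ℝ) - 1) * K * (‖sgrad h p‖ ^ 2 / (β - h p) ^ 2)
        - 2 * (α + h p / (β - h p) + (1 - β) / (β - h p)) * (D * Real.exp (h p)) ^ (α - 1)
            * q p * (‖sgrad h p‖ ^ 2 / (β - h p) ^ 2)
        - 2 / (β - h p) ^ 2 * (D * Real.exp (h p)) ^ (α - 1) * ⟪sgrad h p, sgrad q p⟫ := by
  
  intro p hp
  -- smoothness
  have hF : ContDiffOn ℝ (⊤ : ℕ∞) (fun z : EuclideanSpace ℝ (Fin N) × ℝ => f z.1) U :=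
    (hf.comp contDiff_fst).contDiffOn
  have dh : ∀ z ∈ U, DifferentiableAt ℝ h z := smooth_diff hU hh
  have dq : ∀ z ∈ U, DifferentiableAt ℝ q z := smooth_diff hU hq
  set W : EuclideanSpace ℝ (Fin N) × ℝ → ℝ :=
    fun z => (∑ j, dd (ee j) h z ^ 2) * (β - h z)⁻¹ ^ 2 with hW
  set w : EuclideanSpace ℝ (Fin N) × ℝ → ℝ :=
    fun p' => ‖sgrad h p'‖ ^ 2 / (β - h p') ^ 2 with hw
  have hwW : ∀ z ∈ U, w z = W z := by
    intro z hz
    simp only [hw, hW]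
    rw [norm_sgrad (dh z hz), inv_pow, div_eq_mul_inv]
  have sW : ContDiffOn ℝ (⊤ : ℕ∞) W U := by
    refine ContDiffOn.mul (ContDiffOn.sum fun j _ => (smooth_dd hU hh _).pow 2) ?_
    exact ((contDiffOn_const.sub hh).inv fun z hz => (hβ z hz).ne').pow 2
  have sw : ContDiffOn ℝ (⊤ : ℕ∞) w U := sW.congr hwW
  have dw := smooth_diff hU sw p hp
  have w1 : ∀ a, ∀ z ∈ U, dd a w z = dd a W z := fun a => dd_congr hU hwW a
  have w2 : ∀ a, dd a (dd a w) p = dd a (dd a W) p := fun a => dd_congr hU (w1 a) a p hp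
  -- abbreviations
  set g : Fin N → ℝ := fun i => dd (ee i) h p with hg
  set H : Fin N → Fin N → ℝ := fun i j => dd (ee i) (dd (ee j) h) p with hH
  set φ : Fin N → ℝ := fun i => dd (ee i) (fun z => f z.1) p with hφ
  set C : ℝ := (β - h p)⁻¹ with hC
  set P : ℝ := (D * Real.exp (h p)) ^ (α - 1) with hP
  set G : ℝ := ∑ i, g i ^ 2 with hG
  -- the equation
  have pde : ∀ z ∈ U, (∑ i, dd (ee i) (dd (ee i) h) z)
      - (∑ i, dd (ee i) (fun z => f z.1) z * dd (ee i) h z) - dd et h z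
      + (∑ i, dd (ee i) h z ^ 2) + q z * (D * Real.exp (h z)) ^ (α - 1) = 0 := by
    intro z hz
    have := heq z hz
    rwa [swlap_eq hU hf hh hz, tderiv_eq (dh z hz), norm_sgrad (dh z hz)] at this
  have pde0 : (∑ i, H i i) - (∑ i, φ i * g i) - dd et h p + G + q p * P = 0 := pde p hp
  have hsymm : ∀ i j, H i j = H j i := fun i j => dd_comm hU hh _ _ p hp
  have pde1 : ∀ j, (∑ i, dd (ee j) (dd (ee i) (dd (ee i) h)) p)
      - (∑ i, (dd (ee j) (dd (ee i) (fun z => f z.1)) p * g i + φ i * H j i))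
      - dd (ee j) (dd et h) p + 2 * (∑ i, g i * H j i)
      + (dd (ee j) q p * P + q p * ((α - 1) * P * g j)) = 0 := by
    intro j
    have h1 := dd_congr hU pde (ee j) p hp
    have d1 : ∀ a, DifferentiableAt ℝ (dd a h) p := fun a =>
      smooth_diff hU (smooth_dd hU hh _) p hp
    have d2 : ∀ i, DifferentiableAt ℝ (dd (ee i) (dd (ee i) h)) p := fun i =>
      smooth_diff hU (smooth_dd hU (smooth_dd hU hh _) _) p hp
    have dF : ∀ i : Fin N, DifferentiableAt ℝ
        (dd (ee i) (fun z : EuclideanSpace ℝ (Fin N) × ℝ => f z.1)) p :=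
      fun i => smooth_diff hU (smooth_dd hU hF _) p hp
    obtain ⟨dP, eP⟩ := dd_rpow D α hD (dh p hp) (ee j)
    have dA := DifferentiableAt.fun_sum (u := Finset.univ) fun i _ => d2 i
    have dB := DifferentiableAt.fun_sum (u := Finset.univ) fun i _ => (dF i).fun_mul (d1 (ee i))
    have dG := DifferentiableAt.fun_sum (u := Finset.univ) fun i _ => (d1 (ee i)).fun_pow 2
    rw [dd_const, dd_add (((dA.fun_sub dB).fun_sub (d1 et)).fun_add dG) ((dq p hp).fun_mul dP),
      dd_add ((dA.fun_sub dB).fun_sub (d1 et)) dG, dd_sub (dA.fun_sub dB) (d1 et), dd_sub dA dB,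
      dd_mul (dq p hp) dP, eP, dd_sum d2, dd_sum (fun i => (dF i).fun_mul (d1 (ee i))),
      dd_sum (fun i => (d1 (ee i)).fun_pow 2)] at h1
    simp only [dd_pow (d1 _), dd_mul (dF _) (d1 _)] at h1
    rw [← h1, Finset.mul_sum]
    congr 2
    refine Finset.sum_congr rfl fun i _ => ?_
    simp only [hg, hH]
    norm_num
    ring
  set Z : ℝ := ∑ i, ∑ j, g j * dd (ee j) (dd (ee i) (dd (ee i) h)) p with hZ
  set X : ℝ := ∑ i, ∑ j, g i * g j * H i j with hX
  set Y : ℝ := ∑ i, φ i * ∑ j, g j * H i j with hY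
  set τ : ℝ := ∑ j, g j * dd (ee j) (dd et h) p with hτ
  set Q : ℝ := ∑ j, g j * dd (ee j) q p with hQ
  set Φ : ℝ := ∑ i, ∑ j, g i * g j * dd (ee i) (dd (ee j) (fun z => f z.1)) p with hΦ
  set HH : ℝ := ∑ i, ∑ j, H i j ^ 2 with hHH
  have pde2 : Z - Φ - Y - τ + 2 * X + Q * P + q p * (α - 1) * P * G = 0 := by
    have h1 : ∑ j, g j * ((∑ i, dd (ee j) (dd (ee i) (dd (ee i) h)) p)
      - (∑ i, (dd (ee j) (dd (ee i) (fun z => f z.1)) p * g i + φ i * H j i))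
      - dd (ee j) (dd et h) p + 2 * (∑ i, g i * H j i)
      + (dd (ee j) q p * P + q p * ((α - 1) * P * g j))) = 0 :=
      Finset.sum_eq_zero fun j _ => by rw [pde1 j, mul_zero]
    rw [← h1]
    have hZ' : Z = ∑ j, g j * ∑ i, dd (ee j) (dd (ee i) (dd (ee i) h)) p := by
      rw [hZ, Finset.sum_comm]
      simp only [Finset.mul_sum]
    have hY' : Y = ∑ j, g j * ∑ i, φ i * H j i := by
      rw [hY]
      simp only [Finset.mul_sum]
      rw [Finset.sum_comm]
      refine Finset.sum_congr rfl fun i _ => Finset.sum_congr rfl fun j _ => ?_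
      rw [hsymm i j]
      ring
    have hX' : X = ∑ j, g j * ∑ i, g i * H j i := by
      rw [hX]
      simp only [Finset.mul_sum, mul_assoc]
    have hΦ' : Φ = ∑ j, g j * ∑ i, dd (ee j) (dd (ee i) (fun z => f z.1)) p * g i := by
      rw [hΦ]
      simp only [Finset.mul_sum]
      refine Finset.sum_congr rfl fun i _ => Finset.sum_congr rfl fun j _ => ?_
      ring
    rw [hZ', hY', hX', hΦ', hτ, hQ, hG]
    simp only [Finset.sum_add_distrib (s := Finset.univ (α := Fin N)), mul_add, mul_sub, Finset.sum_sub_distrib]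
    have e1 : ∑ x, g x * (2 * ∑ i, g i * H x i) = 2 * ∑ j, g j * ∑ i, g i * H j i := by
      rw [Finset.mul_sum]
      exact Finset.sum_congr rfl fun i _ => by ring
    have e2 : ∑ x, g x * (dd (ee x) q p * P) = (∑ j, g j * dd (ee j) q p) * P := by
      rw [Finset.sum_mul]
      exact Finset.sum_congr rfl fun i _ => by ring
    have e3 : ∑ x, g x * (q p * ((α - 1) * P * g x)) = q p * (α - 1) * P * ∑ i, g i ^ 2 := by
      rw [Finset.mul_sum]
      exact Finset.sum_congr rfl fun i _ => by ring
    rw [e1, e2, e3]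
    ring
  -- the left-hand side
  have eL : swlap f w p - tderiv w p = 2 * HH * C ^ 2 + 2 * Z * C ^ 2 + 8 * X * C ^ 3
      + 6 * G ^ 2 * C ^ 4 + 2 * G * C ^ 3 * (∑ i, H i i) - 2 * Y * C ^ 2
      - 2 * G * C ^ 3 * (∑ i, φ i * g i) - 2 * τ * C ^ 2 - 2 * G * C ^ 3 * dd et h p := by
    rw [swlap_eq hU hf sw hp, tderiv_eq dw]
    simp only [w2, w1 _ p hp]
    have a2 : ∀ i, dd (ee i) (dd (ee i) W) p = 2 * (∑ j, H i j ^ 2) * C ^ 2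
        + 2 * (∑ j, g j * dd (ee j) (dd (ee i) (dd (ee i) h)) p) * C ^ 2
        + 8 * (∑ j, g j * H i j) * C ^ 3 * g i + 6 * G * C ^ 4 * g i ^ 2
        + 2 * G * C ^ 3 * H i i := fun i => dd_w2 hU hh β hβ ee (ee i) p hp
    have a1 : ∀ i, dd (ee i) W p = 2 * ((∑ j, g j * H i j) * C ^ 2) + 2 * (G * (C ^ 3 * g i)) :=
      fun i => dd_w1 hU hh β hβ ee (ee i) p hp
    have at1 : dd et W p = 2 * ((∑ j, g j * dd et (dd (ee j) h) p) * C ^ 2)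
        + 2 * (G * (C ^ 3 * dd et h p)) := dd_w1 hU hh β hβ ee et p hp
    have et' : ∑ j, g j * dd et (dd (ee j) h) p = τ :=
      Finset.sum_congr rfl fun j _ => by rw [dd_comm hU hh et (ee j) p hp]
    rw [at1, et']
    simp only [a1, a2]
    have s2 : ∑ i, (2 * (∑ j, H i j ^ 2) * C ^ 2
        + 2 * (∑ j, g j * dd (ee j) (dd (ee i) (dd (ee i) h)) p) * C ^ 2
        + 8 * (∑ j, g j * H i j) * C ^ 3 * g i + 6 * G * C ^ 4 * g i ^ 2
        + 2 * G * C ^ 3 * H i i) = 2 * HH * C ^ 2 + 2 * Z * C ^ 2 + 8 * X * C ^ 3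
      + 6 * G ^ 2 * C ^ 4 + 2 * G * C ^ 3 * (∑ i, H i i) := by
      have hX' : X = ∑ j, (∑ i, g i * H j i) * g j := by
        rw [hX]
        simp only [Finset.sum_mul]
        exact Finset.sum_congr rfl fun i _ => Finset.sum_congr rfl fun j _ => by ring
      have hG2 : G ^ 2 = G * ∑ i, g i ^ 2 := by rw [← hG]; ring
      rw [hHH, hZ, hX', hG2]
      clear_value G
      simp only [Finset.sum_add_distrib, Finset.mul_sum (s := Finset.univ (α := Fin N)) (f := fun i => H i i),
        Finset.mul_sum (s := Finset.univ (α := Fin N)) (f := fun i => g i ^ 2)]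
      have k1 : ∀ (c d : ℝ) (F : Fin N → ℝ), c * (∑ i, F i) * d = ∑ i, c * F i * d := by
        intro c d F
        rw [Finset.mul_sum, Finset.sum_mul]
      rw [k1 2 (C ^ 2) (fun i => ∑ j, H i j ^ 2), k1 2 (C ^ 2) (fun i => ∑ j, g j * dd (ee j) (dd (ee i) (dd (ee i) h)) p),
        k1 8 (C ^ 3) (fun j => (∑ i, g i * H j i) * g j), k1 6 (C ^ 4) (fun i => G * g i ^ 2)]
      congr 1
      congr 1
      · congr 1
        exact Finset.sum_congr rfl fun i _ => by ring
      · exact Finset.sum_congr rfl fun i _ => by ring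
    have s1 : ∑ i, φ i * (2 * ((∑ j, g j * H i j) * C ^ 2) + 2 * (G * (C ^ 3 * g i)))
        = 2 * Y * C ^ 2 + 2 * G * C ^ 3 * (∑ i, φ i * g i) := by
      rw [hY]
      clear_value G
      rw [Finset.mul_sum, Finset.sum_mul, Finset.mul_sum, ← Finset.sum_add_distrib]
      exact Finset.sum_congr rfl fun i _ => by ring
    rw [s1, s2]
    ring
  -- the gradient term
  have eN : ‖sgrad h p‖ ^ 2 = G := norm_sgrad (dh p hp)
  have eI : ⟪sgrad h p, sgrad w p⟫ = 2 * X * C ^ 2 + 2 * G ^ 2 * C ^ 3 := by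
    rw [inner_coord]
    simp only [sgrad_apply (dh p hp), sgrad_apply dw, w1 _ p hp]
    have a1 : ∀ i, dd (ee i) W p = 2 * ((∑ j, g j * H i j) * C ^ 2) + 2 * (G * (C ^ 3 * g i)) :=
      fun i => dd_w1 hU hh β hβ ee (ee i) p hp
    simp only [a1]
    have hX' : X = ∑ j, g j * ∑ i, g i * H j i := by
      rw [hX]
      simp only [Finset.mul_sum, mul_assoc]
    have hG2 : G ^ 2 = G * ∑ i, g i ^ 2 := by rw [← hG]; ring
    rw [hX', hG2]
    clear_value G
    rw [Finset.mul_sum, Finset.sum_mul, Finset.mul_sum, Finset.mul_sum, Finset.sum_mul,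
      ← Finset.sum_add_distrib]
    exact Finset.sum_congr rfl fun i _ => by ring
  have eQ : ⟪sgrad h p, sgrad q p⟫ = Q := by
    rw [inner_coord]
    simp only [sgrad_apply (dh p hp), sgrad_apply (dq p hp)]
    rfl
  have hΦle : -(((N : ℝ) - 1) * K * G) ≤ Φ := by
    have := hRic p.1 (sgrad h p)
    rw [eN, hess_f hf p] at this
    simpa only [sgrad_apply (dh p hp)] using this
  have hsq : 0 ≤ HH + 2 * X * C + G ^ 2 * C ^ 2 := by
    have : HH + 2 * X * C + G ^ 2 * C ^ 2 = ∑ i, ∑ j, (H i j + C * (g i * g j)) ^ 2 := by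
      have hG2 : G ^ 2 = ∑ i, ∑ j, g i ^ 2 * g j ^ 2 := by
        rw [sq, hG, Finset.sum_mul_sum]
      rw [hG2, hHH, hX]
      simp only [Finset.mul_sum, Finset.sum_mul, ← Finset.sum_add_distrib]
      exact Finset.sum_congr rfl fun i _ => Finset.sum_congr rfl fun j _ => by ring
    rw [this]
    exact Finset.sum_nonneg fun i _ => Finset.sum_nonneg fun j _ => sq_nonneg _
  have hB : 0 < β - h p := hβ p hp
  have hCB : (β - h p) * C = 1 := mul_inv_cancel₀ hB.ne'
  have hhp : h p = β - (β - h p) := by ring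
  rw [eL, eI, eN, eQ]
  simp only [div_eq_mul_inv, ← inv_pow]
  rw [← hC]
  have key : 0 ≤ 2 * C ^ 2 * (HH + 2 * X * C + G ^ 2 * C ^ 2)
      + 2 * C ^ 2 * (Φ + ((N : ℝ) - 1) * K * G) := by
    have : 0 ≤ Φ + ((N : ℝ) - 1) * K * G := by linarith
    positivity
  clear_value C P G Z X Y τ Q Φ HH
  have hhC : h p * C = β * C - 1 := by linarith
  have r1 : 2 * (h p + (1 - β)) * C = 2 * (C - 1) := by linear_combination 2 * hhC
  have r2 : 2 * (β - h p) * (G * C ^ 2) ^ 2 = 2 * G ^ 2 * C ^ 3 := by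
    linear_combination 2 * G ^ 2 * C ^ 3 * hCB
  have r3 : α + h p * C + (1 - β) * C = α - 1 + C := by linear_combination hhC
  rw [r1, r2, r3, ge_iff_le, ← sub_nonneg]
  refine le_of_le_of_eq key ?_
  linear_combination (-2 * G * C ^ 3) * pde0 + (-2 * C ^ 2) * pde2
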